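/- arXiv:2306.13282 — 3 statements merged into one kernel-verified Lean document; each statement's English description precedes it below -/
import Mathlib

section
/- For every graph G, glc(G) ≤ 3·odw(G), where glc(G) is the maximum load of a geodesic loaded cycle of G and odw(G) is the outer diameter-width. -/
open SimpleGraph

/-- A tree-decomposition of `G`: a tree `T` with a bag `B t ⊆ V(G)` for each vertex `t`,
covering all vertices and edges, such that if `t₂` lies on the path of `T` between `t₁`
and `t₃` then `B t₁ ∩ B t₃ ⊆ B t₂`. -/
structure TreeDecomp {V W : Type*} (G : SimpleGraph V) (T : SimpleGraph W) (B : W → Set V) : Prop where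
  isTree : T.IsTree
  coversVertices : ∀ v : V, ∃ t : W, v ∈ B t
  coversEdges : ∀ ⦃u v : V⦄, G.Adj u v → ∃ t : W, u ∈ B t ∧ v ∈ B t
  interpolation : ∀ ⦃t₁ t₂ t₃ : W⦄ (p : T.Walk t₁ t₃), p.IsPath → t₂ ∈ p.support →
    B t₁ ∩ B t₃ ⊆ B t₂

/-- `(C, F)` is a geodesic loaded cycle of `G`: `C` is a cycle, `F` a set of edges of `C`,
and for all vertices `u, v` of `C`, one of the two paths of `C` between `u` and `v`
contains at most `d_G(u,v)` edges of `F`. -/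
def IsGeodesicLoadedCycle {V : Type*} [DecidableEq V] (G : SimpleGraph V) {a : V}
    (C : G.Walk a a) (F : Finset (Sym2 V)) : Prop :=
  C.IsCycle ∧ (∀ e ∈ F, e ∈ C.edges) ∧
    ∀ u v : V, u ∈ C.support → v ∈ C.support →
      ∃ P : G.Walk u v, P.IsPath ∧ (∀ e ∈ P.edges, e ∈ C.edges) ∧
        (F ∩ P.edges.toFinset).card ≤ G.dist u v


theorem td_near {W : Type*} {T : SimpleGraph W} {m r y : W} (p : T.Walk m r)
    (hp : p.length = T.dist m r) (hy : y ∈ p.support) (hd : T.dist m r ≤ T.dist y r) : y = m := by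
  obtain ⟨q, s, rfl⟩ := p.mem_support_iff_exists_append.mp hy
  rw [Walk.length_append] at hp
  have := dist_le s
  exact (Walk.eq_of_length_eq_zero (p := q) (by omega)).symm

theorem td_top {V W : Type*} {G : SimpleGraph V} {T : SimpleGraph W} {B : W → Set V}
    (hTD : TreeDecomp G T B) (r : W) (v : V) (m : W) (hm : v ∈ B m)
    (hmin : ∀ t, v ∈ B t → T.dist m r ≤ T.dist t r) (t : W) (ht : v ∈ B t) :
    ∃ (q : T.Walk t m) (p : T.Walk m r), q.IsPath ∧ p.length = T.dist m r ∧
      (q.append p).IsPath := by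
  obtain ⟨q, hq, -⟩ := hTD.isTree.existsUnique_path t m
  obtain ⟨p, hp, hpl⟩ := hTD.isTree.connected.exists_path_of_dist m r
  refine ⟨q, p, hq, hpl, ?_⟩
  rw [Walk.isPath_def, Walk.support_append, List.nodup_append']
  refine ⟨hq.support_nodup, hp.support_nodup.tail, ?_⟩
  intro y hy hy'
  have hyB : v ∈ B y := hTD.interpolation q hq hy ⟨ht, hm⟩
  have := td_near p hpl (List.mem_of_mem_tail hy') (hmin y hyB)
  subst this
  have h := hp.support_nodup
  rw [← Walk.cons_tail_support] at h
  exact (List.nodup_cons.mp h).1 hy'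

theorem td_simplicial {V W : Type*} {G : SimpleGraph V} {T : SimpleGraph W} {B : W → Set V}
    (hTD : TreeDecomp G T B) (S : Finset V) (hS : S.Nonempty) :
    ∃ v ∈ S, ∃ m, v ∈ B m ∧ ∀ u ∈ S, (∃ t, u ∈ B t ∧ v ∈ B t) → u ∈ B m := by
  obtain ⟨r⟩ := hTD.isTree.connected.nonempty
  have hex : ∀ v : V, ∃ m, v ∈ B m ∧ ∀ t, v ∈ B t → T.dist m r ≤ T.dist t r := by
    intro v
    obtain ⟨m, hm, h⟩ := exists_minimalFor_of_wellFoundedLT (fun t => v ∈ B t)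
      (fun t => T.dist t r) (hTD.coversVertices v)
    exact ⟨m, hm, fun t ht => by
      by_contra hc
      have := h ht (by simp only at *; omega)
      simp only at this
      omega⟩
  choose top htop hmin using hex
  obtain ⟨v, hv, hmax⟩ := S.exists_max_image (fun v => T.dist (top v) r) hS
  refine ⟨v, hv, top v, htop v, ?_⟩
  rintro u hu ⟨t, hut, hvt⟩
  obtain ⟨q, p, hq, hp, hqp⟩ := td_top hTD r v (top v) (htop v) (hmin v) t hvt
  obtain ⟨q', p', hq', hp', hqp'⟩ := td_top hTD r u (top u) (htop u) (hmin u) t hut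
  have heq := (hTD.isTree.existsUnique_path t r).unique hqp hqp'
  have hmem : top v ∈ (q.append p).support := by
    rw [Walk.mem_support_append_iff]; exact Or.inl q.end_mem_support
  rw [heq, Walk.mem_support_append_iff] at hmem
  rcases hmem with h | h
  · exact hTD.interpolation q' hq' h ⟨hut, htop u⟩
  · rw [td_near p' hp' h (hmax u hu)]
    exact htop u

theorem td_glue {V W : Type*} {G : SimpleGraph V} {T : SimpleGraph W} {B : W → Set V}
    (hTD : TreeDecomp G T B) (δ : V → V → ℤ) (S : Finset V)
    (hδ : ∀ u ∈ S, ∀ v ∈ S, ∀ w ∈ S, (∃ t, u ∈ B t ∧ v ∈ B t) → (∃ t, v ∈ B t ∧ w ∈ B t) →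
      (∃ t, u ∈ B t ∧ w ∈ B t) → δ u v + δ v w = δ u w) :
    ∃ h : V → ℤ, ∀ u ∈ S, ∀ v ∈ S, (∃ t, u ∈ B t ∧ v ∈ B t) → h v - h u = δ u v := by
  classical
  induction S using Finset.strongInduction with
  | H S ih =>
    rcases S.eq_empty_or_nonempty with rfl | hS
    · exact ⟨fun _ => 0, by simp⟩
    obtain ⟨x, hx, m, hxm, hm⟩ := td_simplicial hTD S hS
    obtain ⟨h, hh⟩ := ih (S.erase x) (Finset.erase_ssubset hx) (fun u hu v hv w hw =>
      hδ u (Finset.mem_of_mem_erase hu) v (Finset.mem_of_mem_erase hv) w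
        (Finset.mem_of_mem_erase hw))
    have hself : ∀ u ∈ S, δ u u = 0 := by
      intro u hu
      have hc : ∃ t, u ∈ B t ∧ u ∈ B t := by
        obtain ⟨t, ht⟩ := hTD.coversVertices u; exact ⟨t, ht, ht⟩
      have := hδ u hu u hu u hu hc hc hc
      omega
    have hanti : ∀ u ∈ S, ∀ v ∈ S, (∃ t, u ∈ B t ∧ v ∈ B t) → δ u v + δ v u = 0 := by
      intro u hu v hv hc
      obtain ⟨t, h1, h2⟩ := hc
      rw [hδ u hu v hv u hu ⟨t, h1, h2⟩ ⟨t, h2, h1⟩ ⟨t, h1, h1⟩, hself u hu]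
    have hval : ∃ c : ℤ, ∀ u ∈ S, u ≠ x → (∃ t, u ∈ B t ∧ x ∈ B t) → c - h u = δ u x := by
      by_cases hn : ∃ u ∈ S, u ≠ x ∧ ∃ t, u ∈ B t ∧ x ∈ B t
      · obtain ⟨u₀, hu₀, hne₀, hc₀⟩ := hn
        refine ⟨h u₀ + δ u₀ x, fun u hu hne hc => ?_⟩
        have hb := hm u hu hc
        have hb₀ := hm u₀ hu₀ hc₀
        have e1 := hh u (Finset.mem_erase.mpr ⟨hne, hu⟩) u₀ (Finset.mem_erase.mpr ⟨hne₀, hu₀⟩)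
          ⟨m, hb, hb₀⟩
        have e2 := hδ u hu u₀ hu₀ x hx ⟨m, hb, hb₀⟩ hc₀ hc
        omega
      · exact ⟨0, fun u hu hne hc => (hn ⟨u, hu, hne, hc⟩).elim⟩
    obtain ⟨c, hc⟩ := hval
    refine ⟨fun y => if y = x then c else h y, fun u hu v hv huv => ?_⟩
    have huv' : ∃ t, v ∈ B t ∧ u ∈ B t := by
      obtain ⟨t, h1, h2⟩ := huv; exact ⟨t, h2, h1⟩
    by_cases h1 : u = x <;> by_cases h2 : v = x
    · subst h1; subst h2; simp [hself _ hu]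
    · subst h1
      have e1 := hc v hv h2 huv'
      have e2 := hanti u hu v hv huv
      simp only [if_true, if_neg h2]
      omega
    · subst h2
      simp only [if_true, if_neg h1]
      exact hc u hu h1 huv
    · simp only [if_neg h1, if_neg h2]
      exact hh u (Finset.mem_erase.mpr ⟨h1, hu⟩) v (Finset.mem_erase.mpr ⟨h2, hv⟩) huv

theorem walk_sum {V : Type*} {G : SimpleGraph V} (f : Sym2 V → ℤ) {a b : V} (p : G.Walk a b) :
    ∑ j ∈ Finset.range p.length, f s(p.getVert j, p.getVert (j + 1)) = (p.edges.map f).sum := by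
  induction p with
  | nil => simp
  | cons hadj p ih =>
    rw [Walk.length_cons, Finset.sum_range_succ']
    simp only [Walk.getVert_cons_succ, Walk.getVert_zero, Walk.edges_cons, List.map_cons,
      List.sum_cons, ih]
    ring

theorem list_ind_sum {α : Type*} [DecidableEq α] (F : Finset α) (l : List α) (hl : l.Nodup) :
    (l.map (fun e => if e ∈ F then (1 : ℤ) else 0)).sum = ((F ∩ l.toFinset).card : ℤ) := by
  rw [← List.sum_toFinset _ hl, Finset.sum_boole, Finset.filter_mem_eq_inter, Finset.inter_comm]

theorem walk_lift {V : Type*} {G : SimpleGraph V} (L : ℤ) (φ : V → ℤ) (f : Sym2 V → ℤ)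
    (E : List (Sym2 V))
    (hstep : ∀ u v, s(u, v) ∈ E → ∃ k : ℤ, |k| ≤ f s(u, v) ∧ L ∣ φ v - φ u - k)
    {u v : V} (p : G.Walk u v) (hp : ∀ e ∈ p.edges, e ∈ E) :
    ∃ k : ℤ, |k| ≤ (p.edges.map f).sum ∧ L ∣ φ v - φ u - k := by
  induction p with
  | nil => exact ⟨0, by simp⟩
  | @cons u v w hadj p ih =>
    simp only [Walk.edges_cons, List.mem_cons, forall_eq_or_imp] at hp
    obtain ⟨k, hk, hd⟩ := ih hp.2
    obtain ⟨k', hk', hd'⟩ := hstep _ _ hp.1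
    refine ⟨k + k', ?_, ?_⟩
    · simp only [Walk.edges_cons, List.map_cons, List.sum_cons]
      have := abs_add_le k k'
      omega
    · obtain ⟨x, hx⟩ := hd
      obtain ⟨y, hy⟩ := hd'
      exact ⟨x + y, by linear_combination hx + hy⟩

theorem exists_phi {V : Type*} {G : SimpleGraph V} {a : V} (C : G.Walk a a) (hC : C.IsCycle)
    (c : ℕ → ℤ) (L : ℤ) (h0 : c 0 = 0) (hL : c C.length = L) :
    ∃ φ : V → ℤ, ∀ i ≤ C.length, L ∣ φ (C.getVert i) - c i := by
  classical
  have hpos : 3 ≤ C.length := hC.three_le_length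
  refine ⟨fun x => if h : ∃ i, i ≤ C.length - 1 ∧ C.getVert i = x then c h.choose else 0, ?_⟩
  have key : ∀ i ≤ C.length - 1, (fun x => if h : ∃ i, i ≤ C.length - 1 ∧ C.getVert i = x then c h.choose else 0) (C.getVert i) = c i := by
    intro i hi
    have h : ∃ j, j ≤ C.length - 1 ∧ C.getVert j = C.getVert i := ⟨i, hi, rfl⟩
    simp only [dif_pos h]
    rw [hC.getVert_injOn' h.choose_spec.1 hi h.choose_spec.2]
  intro i hi
  rcases Nat.lt_or_ge i C.length with h | h
  · rw [key i (by omega)]; simp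
  · have : i = C.length := le_antisymm hi h
    subst this
    have h1 : C.getVert C.length = C.getVert 0 := by simp
    rw [h1, key 0 (by omega), h0, hL]; simp

theorem small_dvd {L x : ℤ} (hL : L ∣ x) (hx : |x| < L) : x = 0 :=
  Int.eq_zero_of_abs_lt_dvd hL hx

/-- glc(G) ≤ 3·odw(G): if G has a tree-decomposition of outer diameter at most d, then every
geodesic loaded cycle of G has load at most 3d. -/
theorem stmt_5 {V W : Type*} [DecidableEq V] (G : SimpleGraph V) (T : SimpleGraph W)
    (B : W → Set V) (hTD : TreeDecomp G T B) (d : ℕ)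
    (houter : ∀ t, ∀ u ∈ B t, ∀ v ∈ B t, G.dist u v ≤ d)
    {a : V} (C : G.Walk a a) (F : Finset (Sym2 V))
    (hgeo : IsGeodesicLoadedCycle G C F) :
    F.card ≤ 3 * d := by
  by_contra hcon
  push Not at hcon
  obtain ⟨hC, hF, hg⟩ := hgeo
  have hlen : 3 ≤ C.length := hC.three_le_length
  have hd1 : 1 ≤ d := by
    have hadj := C.adj_getVert_succ (i := 0) (by omega)
    obtain ⟨t, h1, h2⟩ := hTD.coversEdges hadj
    have := houter t _ h1 _ h2
    rwa [dist_eq_one_iff_adj.mpr hadj] at this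
  let f : Sym2 V → ℤ := fun e => if e ∈ F then 1 else 0
  have hf : ∀ e, 0 ≤ f e ∧ f e ≤ 1 := by
    intro e; simp only [f]; split_ifs <;> simp
  let c : ℕ → ℤ := fun i => ∑ j ∈ Finset.range i, f s(C.getVert j, C.getVert (j + 1))
  have hcs : ∀ i, c (i + 1) = c i + f s(C.getVert i, C.getVert (i + 1)) := fun i =>
    Finset.sum_range_succ _ _
  have hcn : c C.length = F.card := by
    simp only [c]
    rw [walk_sum f C, list_ind_sum F _ hC.edges_nodup]
    congr 2
    exact Finset.inter_eq_left.mpr fun e he => List.mem_toFinset.mpr (hF e he)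
  obtain ⟨φ, hφ⟩ := exists_phi C hC c F.card (by simp [c]) hcn
  have hfwd : ∀ i < C.length, (F.card : ℤ) ∣
      φ (C.getVert (i + 1)) - φ (C.getVert i) - f s(C.getVert i, C.getVert (i + 1)) := by
    intro i hi
    obtain ⟨x, hx⟩ := hφ (i + 1) hi
    obtain ⟨y, hy⟩ := hφ i hi.le
    rw [hcs] at hx
    exact ⟨x - y, by linear_combination hx - hy⟩
  have hstep : ∀ u v, s(u, v) ∈ C.edges → ∃ k : ℤ, |k| ≤ f s(u, v) ∧
      (F.card : ℤ) ∣ φ v - φ u - k := by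
    intro u v he
    obtain ⟨i, hi, hii⟩ := (C.mk_mem_edges_iff_exists).mp he
    have h := hfwd i hi
    rw [hii] at h
    rcases Sym2.eq_iff.mp hii with ⟨h1, h2⟩ | ⟨h1, h2⟩
    · rw [h1, h2] at h
      exact ⟨_, (abs_of_nonneg (hf _).1).le, h⟩
    · rw [h1, h2] at h
      refine ⟨-f s(u, v), by rw [abs_neg]; exact (abs_of_nonneg (hf _).1).le, ?_⟩
      obtain ⟨x, hx⟩ := h
      exact ⟨-x, by linear_combination -hx⟩
  have hpair : ∀ u v, ∃ k : ℤ, u ∈ C.support → v ∈ C.support → (∃ t, u ∈ B t ∧ v ∈ B t) →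
      |k| ≤ d ∧ (F.card : ℤ) ∣ φ v - φ u - k := by
    intro u v
    by_cases hh : u ∈ C.support ∧ v ∈ C.support ∧ ∃ t, u ∈ B t ∧ v ∈ B t
    · obtain ⟨hu, hv, t, hut, hvt⟩ := hh
      obtain ⟨P, hP, hPC, hcard⟩ := hg u v hu hv
      obtain ⟨k, hk, hdv⟩ := walk_lift _ φ f C.edges hstep P hPC
      rw [list_ind_sum F _ hP.isTrail.edges_nodup] at hk
      have := houter t u hut v hvt
      exact ⟨k, fun _ _ _ => ⟨by omega, hdv⟩⟩
    · exact ⟨0, fun h1 h2 h3 => (hh ⟨h1, h2, h3⟩).elim⟩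
  choose δ hδ using hpair
  obtain ⟨h, hh⟩ := td_glue hTD δ C.support.toFinset (by
    intro u hu v hv w hw h1 h2 h3
    rw [List.mem_toFinset] at hu hv hw
    obtain ⟨a1, b1⟩ := hδ u v hu hv h1
    obtain ⟨a2, b2⟩ := hδ v w hv hw h2
    obtain ⟨a3, b3⟩ := hδ u w hu hw h3
    have hz := small_dvd (L := F.card) (x := δ u v + δ v w - δ u w) (by
      obtain ⟨x, hx⟩ := b1
      obtain ⟨y, hy⟩ := b2
      obtain ⟨z, hz⟩ := b3
      exact ⟨z - x - y, by linear_combination hz - hx - hy⟩) (by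
      rw [abs_le] at a1 a2 a3
      rw [abs_lt]
      omega)
    omega)
  have hsum : ∀ i ≤ C.length, h (C.getVert i) - h (C.getVert 0) = c i := by
    intro i
    induction i with
    | zero => intro _; simp [c]
    | succ i ih =>
      intro hi
      have hs := ih (by omega)
      have hu : C.getVert i ∈ C.support := C.getVert_mem_support i
      have hv : C.getVert (i + 1) ∈ C.support := C.getVert_mem_support (i + 1)
      have hb := hTD.coversEdges (C.adj_getVert_succ (i := i) hi)
      have e1 := hh _ (List.mem_toFinset.mpr hu) _ (List.mem_toFinset.mpr hv) hb
      obtain ⟨a1, b1⟩ := hδ _ _ hu hv hb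
      have hfi := hf s(C.getVert i, C.getVert (i + 1))
      have hz := small_dvd (dvd_sub (hfwd i hi) b1) (by
        rw [abs_le] at a1
        rw [abs_lt]
        omega)
      rw [hcs]
      omega
  have hfin := hsum C.length le_rfl
  rw [hcn] at hfin
  simp only [Walk.getVert_length, Walk.getVert_zero] at hfin
  omega
end

section
/- For every graph G, odw(G) − 1 ≤ glc(G). More precisely, glc(G) ≥ 2·⌊odw(G)/2⌋. -/
open SimpleGraph

universe u

theorem ptree {W : Type*} (par : W → W) (lev : W → ℕ) (r : W)
    (h0 : ∀ w, lev w = 0 → w = r) (h1 : ∀ w, lev w ≠ 0 → lev (par w) + 1 = lev w)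
    (T : SimpleGraph W)
    (hT : ∀ a b, T.Adj a b ↔ (lev a ≠ 0 ∧ par a = b) ∨ (lev b ≠ 0 ∧ par b = a)) :
    T.IsTree := by
  classical
  have hr : ∀ n w, lev w = n → T.Reachable w r := by
    intro n
    induction n with
    | zero => intro w hw; rw [h0 w hw]
    | succ n ih =>
      intro w hw
      have h2 := h1 w (by omega)
      have : T.Adj w (par w) := (hT _ _).2 (Or.inl ⟨by omega, rfl⟩)
      exact this.reachable.trans (ih _ (by omega))
  have hne : Nonempty W := ⟨r⟩
  refine ⟨⟨fun x y => (hr _ x rfl).trans (hr _ y rfl).symm⟩, ?_⟩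
  intro v c hc
  obtain ⟨m, hm, hmax⟩ := Finset.exists_max_image c.support.toFinset lev ⟨v, by simp⟩
  have hm' : m ∈ c.support := by simpa using hm
  have hc' : (c.rotate m hm').IsCycle := by simpa using hc
  have key : ∀ x, T.Adj m x → x ∈ (c.rotate m hm').support → par m = x := by
    intro x hx hxs
    have hxc : x ∈ c.support := (Walk.mem_support_rotate_iff c m hm').1 hxs
    have hl := hmax x (by simpa using hxc)
    rcases (hT _ _).1 hx with h | h
    · exact h.2
    · have := h1 x h.1
      rw [h.2] at this
      omega
  have e1 := key _ (Walk.adj_snd hc'.not_nil) (by simp)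
  have e2 := key _ (Walk.adj_penultimate hc'.not_nil).symm (by simp)
  exact hc'.snd_ne_penultimate (e1.symm.trans e2)

theorem fwalk {V : Type*} (G : SimpleGraph V) (f : ℕ → V) (n : ℕ)
    (hf : ∀ j < n, G.Adj (f j) (f (j+1))) :
    ∃ W : G.Walk (f 0) (f n), W.support = (List.range (n+1)).map f ∧
      W.edges = (List.range n).map (fun j => s(f j, f (j+1))) := by
  induction n with
  | zero => exact ⟨Walk.nil, by simp, by simp⟩
  | succ n ih =>
    obtain ⟨W, h1, h2⟩ := ih (fun j hj => hf j (by omega))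
    refine ⟨W.concat (hf n (by omega)), ?_, ?_⟩
    · rw [Walk.support_concat, h1, List.range_succ (n := n+1)]; simp
    · rw [Walk.edges_concat, h2, List.range_succ (n := n)]; simp

def LD {V : Type*} [DecidableEq V] (G : SimpleGraph V) (E : Set (Sym2 V)) (F : Finset (Sym2 V))
    (n : ℕ) (x y : V) : Prop :=
  ∃ W : G.Walk x y, (∀ e ∈ W.edges, e ∈ E) ∧ (F ∩ W.edges.toFinset).card ≤ n

section
variable {V : Type*} [DecidableEq V] {G : SimpleGraph V} {E : Set (Sym2 V)} {F : Finset (Sym2 V)}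

theorem LD.symm {n : ℕ} {x y : V} (h : LD G E F n x y) : LD G E F n y x := by
  obtain ⟨W, h1, h2⟩ := h
  exact ⟨W.reverse, by simpa using h1, by simpa using h2⟩

theorem LD.mono {n m : ℕ} {x y : V} (h : LD G E F n x y) (hnm : n ≤ m) : LD G E F m x y := by
  obtain ⟨W, h1, h2⟩ := h
  exact ⟨W, h1, h2.trans hnm⟩

theorem LD.refl (x : V) : LD G E F 0 x x := ⟨Walk.nil, by simp, by simp⟩

theorem LD.trans {n m : ℕ} {x y z : V} (h : LD G E F n x y) (h' : LD G E F m y z) :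
    LD G E F (n + m) x z := by
  obtain ⟨W, h1, h2⟩ := h
  obtain ⟨W', h1', h2'⟩ := h'
  refine ⟨W.append W', ?_, ?_⟩
  · intro e he
    rw [Walk.edges_append, List.mem_append] at he
    rcases he with he | he
    · exact h1 e he
    · exact h1' e he
  · rw [Walk.edges_append, List.toFinset_append, Finset.inter_union_distrib_left]
    exact (Finset.card_union_le _ _).trans (by omega)

theorem LD.one {x y : V} (h : G.Adj x y) (hE : s(x, y) ∈ E) : LD G E F 1 x y := by
  refine ⟨Walk.cons h Walk.nil, by simpa using hE, ?_⟩
  refine (Finset.card_le_card Finset.inter_subset_right).trans ?_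
  simp

theorem LD.zero {x y : V} (h : G.Adj x y) (hE : s(x, y) ∈ E) (hF : s(x, y) ∉ F) :
    LD G E F 0 x y := by
  refine ⟨Walk.cons h Walk.nil, by simpa using hE, ?_⟩
  simp [hF]

theorem LD.walk {x y : V} (W : G.Walk x y) (hE : ∀ e ∈ W.edges, e ∈ E) (hF : ∀ e ∈ W.edges, e ∉ F)
    {z : V} (hz : z ∈ W.support) : LD G E F 0 x z := by
  refine ⟨W.takeUntil z hz, fun e he => hE e (W.edges_takeUntil_subset_edges hz he), ?_⟩
  rw [Nat.le_zero, Finset.card_eq_zero, Finset.eq_empty_iff_forall_notMem]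
  intro e he
  simp only [Finset.mem_inter, List.mem_toFinset] at he
  exact hF e (W.edges_takeUntil_subset_edges hz he.2) he.1

theorem LD.path {n : ℕ} {x y : V} (h : LD G E F n x y) :
    ∃ P : G.Walk x y, P.IsPath ∧ (∀ e ∈ P.edges, e ∈ E) ∧ (F ∩ P.edges.toFinset).card ≤ n := by
  obtain ⟨W, h1, h2⟩ := h
  refine ⟨W.bypass, W.bypass_isPath, fun e he => h1 e (W.edges_bypass_subset_edges he), ?_⟩
  refine (Finset.card_le_card ?_).trans h2
  apply Finset.inter_subset_inter_left
  intro e he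
  simp only [List.mem_toFinset] at he ⊢
  exact W.edges_bypass_subset_edges he

/-- moving along a sequence -/
theorem LD.seq (f : ℕ → V) (a k : ℕ) (hk : k ≤ a) (hf : ∀ j < a, G.Adj (f j) (f (j+1)))
    (hE : ∀ j < a, s(f j, f (j+1)) ∈ E) (hF : ∀ j < a, k ≤ j → s(f j, f (j+1)) ∉ F) :
    ∀ j' j, j ≤ j' → j' ≤ a → LD G E F (min j' k - min j k) (f j) (f j') := by
  intro j'
  induction j' with
  | zero => intro j hj _; obtain rfl : j = 0 := by omega
            exact (LD.refl _).mono (by omega)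
  | succ n ih =>
    intro j hj hn
    rcases Nat.lt_or_ge j (n+1) with h | h
    · have h1 := ih j (by omega) (by omega)
      rcases Nat.lt_or_ge n k with h2 | h2
      · exact (h1.trans (LD.one (hf n (by omega)) (hE n (by omega)))).mono (by omega)
      · exact (h1.trans (LD.zero (hf n (by omega)) (hE n (by omega)) (hF n (by omega) h2))).mono
          (by omega)
    · obtain rfl : j = n+1 := by omega
      exact (LD.refl _).mono (by omega)

theorem lip_dist (dep : V → ℕ) (hL : ∀ x y, G.Adj x y → dep x ≤ dep y + 1) {x y : V}
    (h : G.Reachable x y) : dep x ≤ dep y + G.dist x y := by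
  obtain ⟨W, hW⟩ := h.exists_walk_length_eq_dist
  rw [← hW]
  clear hW h
  induction W with
  | nil => simp
  | cons h p ih =>
    have := hL _ _ h
    simp only [Walk.length_cons]
    omega

theorem seq_path (dep : V → ℕ) (f : ℕ → V) (a : ℕ) 
    (hfd : ∀ j ≤ a, dep (f j) + j = dep (f 0)) {j j' : ℕ} (hj : j ≤ a) (hj' : j' ≤ a)
    (h : f j = f j') : j = j' := by
  have := hfd j hj
  have := hfd j' hj'
  rw [h] at *
  omega

theorem seq_edge (dep : V → ℕ) (f : ℕ → V) (a : ℕ) 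
    (hfd : ∀ j ≤ a, dep (f j) + j = dep (f 0)) {j j' : ℕ} (hj : j < a) (hj' : j' < a)
    (h : s(f j, f (j+1)) = s(f j', f (j'+1))) : j = j' := by
  rw [Sym2.eq_iff] at h
  rcases h with h | h
  · exact seq_path dep f a hfd hj.le hj'.le h.1
  · have := seq_path dep f a hfd hj.le (by omega) h.1
    have := seq_path dep f a hfd (by omega) hj'.le h.2
    omega

theorem cyc (dep : V → ℕ) (hL : ∀ x y, G.Adj x y → dep x ≤ dep y + 1) (i k a b : ℕ) (f g : ℕ → V)
    (hf : ∀ j < a, G.Adj (f j) (f (j+1))) (hg : ∀ j < b, G.Adj (g j) (g (j+1)))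
    (hfd : ∀ j ≤ a, dep (f j) + j = dep (f 0)) (hgd : ∀ j ≤ b, dep (g j) + j = dep (g 0))
    (hfg : ∀ j ≤ a, ∀ j' ≤ b, f j = g j' → j = a ∧ j' = b) (hm : f a = g b)
    (hfi : dep (f 0) ≤ i) (hfi' : i ≤ dep (f 0) + 1)
    (hgi : dep (g 0) ≤ i) (hgi' : i ≤ dep (g 0) + 1)
    (Q : G.Walk (f 0) (g 0)) (hQ : Q.IsPath)
    (hQi : ∀ x ∈ Q.support, x = f 0 ∨ x = g 0 ∨ i ≤ dep x)
    (hk : 1 ≤ k) (hd : 2 * k ≤ G.dist (f 0) (g 0)) :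
    ∃ (a : V) (C : G.Walk a a) (F : Finset (Sym2 V)),
      IsGeodesicLoadedCycle G C F ∧ 2 * k ≤ F.card := by
  obtain ⟨A, hAs, hAe⟩ := fwalk G f a hf
  obtain ⟨B, hBs, hBe⟩ := fwalk G g b hg
  have hAl : A.length = a := by rw [← Walk.length_edges, hAe]; simp
  have hBl : B.length = b := by rw [← Walk.length_edges, hBe]; simp
  have hab : 2 * k ≤ a + b := by
    have := G.dist_le (A.append ((B.copy rfl hm.symm).reverse))
    simp [hAl, hBl] at this
    omega
  have hda := hfd a le_rfl
  have hdb := hgd b le_rfl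
  rw [hm] at hda
  have hka : k ≤ a := by omega
  have hkb : k ≤ b := by omega
  have dfg : ∀ j ≤ a, ∀ j' ≤ b, 2 * k ≤ j + j' + G.dist (f j) (g j') := by
    intro j hj j' hj'
    obtain ⟨A', _, hA'⟩ := fwalk G f j (fun l hl => hf l (by omega))
    obtain ⟨B', _, hB'⟩ := fwalk G g j' (fun l hl => hg l (by omega))
    have hAl' : A'.length = j := by rw [← Walk.length_edges, hA']; simp
    have hBl' : B'.length = j' := by rw [← Walk.length_edges, hB']; simp
    have hr : G.Reachable (f j) (g j') := A'.reachable.symm.trans (Q.reachable.trans B'.reachable)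
    obtain ⟨W, hW⟩ := hr.exists_walk_length_eq_dist
    have := G.dist_le ((A'.append W).append B'.reverse)
    simp [hAl', hBl', hW] at this
    omega
  have hfQ : ∀ j < a, f (j+1) ∉ Q.support := by
    intro j hj hmem
    have h1 := hfd (j+1) (by omega)
    rcases hQi _ hmem with h | h | h
    · rw [h] at h1; omega
    · have := hfg (j+1) (by omega) 0 (by omega) h
      omega
    · omega
  have hgQ : ∀ j < b, g (j+1) ∉ Q.support := by
    intro j hj hmem
    have h1 := hgd (j+1) (by omega)
    rcases hQi _ hmem with h | h | h
    · have := hfg 0 (by omega) (j+1) (by omega) h.symm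
      omega
    · rw [h] at h1; omega
    · omega
  set R : G.Walk (g 0) (f 0) := (B.copy rfl hm.symm).append A.reverse with hR
  set C := Q.append R with hC
  set ef : ℕ → Sym2 V := fun j => s(f j, f (j+1)) with hef
  set eg : ℕ → Sym2 V := fun j => s(g j, g (j+1)) with heg
  set F : Finset (Sym2 V) := (Finset.range k).image ef ∪ (Finset.range k).image eg with hF
  have hefg : ∀ j < a, ∀ j' < b, ef j ≠ eg j' := by
    intro j hj j' hj' h
    simp only [hef, heg, Sym2.eq_iff] at h
    rcases h with h | h
    · have := hfg j hj.le j' hj'.le h.1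
      omega
    · have := hfg j hj.le (j'+1) (by omega) h.1
      omega
  have hEQ : ∀ e ∈ Q.edges, e ∈ C.edges := by
    intro e he; simp [hC, he]
  have hEf : ∀ j < a, ef j ∈ C.edges := by
    intro j hj
    have : ef j ∈ A.edges := by rw [hAe]; exact List.mem_map.2 ⟨j, by simpa using hj, rfl⟩
    simp [hC, hR, this]
  have hEg : ∀ j < b, eg j ∈ C.edges := by
    intro j hj
    have : eg j ∈ B.edges := by rw [hBe]; exact List.mem_map.2 ⟨j, by simpa using hj, rfl⟩
    simp [hC, hR, this]
  have hFQ : ∀ e ∈ Q.edges, e ∉ F := by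
    intro e he heF
    simp only [hF, Finset.mem_union, Finset.mem_image, Finset.mem_range] at heF
    rcases heF with ⟨j, hj, rfl⟩ | ⟨j, hj, rfl⟩
    · exact hfQ j (by omega) (Q.snd_mem_support_of_mem_edges he)
    · exact hgQ j (by omega) (Q.snd_mem_support_of_mem_edges he)
  have hFf : ∀ j < a, k ≤ j → ef j ∉ F := by
    intro j hj hkj heF
    simp only [hF, Finset.mem_union, Finset.mem_image, Finset.mem_range] at heF
    rcases heF with ⟨j', hj', h⟩ | ⟨j', hj', h⟩
    · have := seq_edge dep f a hfd (by omega) hj h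
      omega
    · exact hefg j hj j' (by omega) h.symm
  have hFg : ∀ j < b, k ≤ j → eg j ∉ F := by
    intro j hj hkj heF
    simp only [hF, Finset.mem_union, Finset.mem_image, Finset.mem_range] at heF
    rcases heF with ⟨j', hj', h⟩ | ⟨j', hj', h⟩
    · exact hefg j' (by omega) j hj h
    · have := seq_edge dep g b hgd (by omega) hj h
      omega
  have hCs : ∀ x ∈ C.support, (∃ j ≤ a, x = f j) ∨ (∃ j ≤ b, x = g j) ∨
      (x ∈ Q.support ∧ i ≤ dep x) := by
    intro x hx
    simp only [hC, hR, Walk.mem_support_append_iff, Walk.support_reverse, Walk.support_copy,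
      List.mem_reverse, hAs, hBs, List.mem_map, List.mem_range] at hx
    rcases hx with hx | ⟨j, hj, rfl⟩ | ⟨j, hj, rfl⟩
    · rcases hQi x hx with h | h | h
      · exact Or.inl ⟨0, by omega, h⟩
      · exact Or.inr (Or.inl ⟨0, by omega, h⟩)
      · exact Or.inr (Or.inr ⟨hx, h⟩)
    · exact Or.inr (Or.inl ⟨j, by omega, rfl⟩)
    · exact Or.inl ⟨j, by omega, rfl⟩
  have hreach : ∀ x ∈ C.support, ∀ y ∈ C.support, G.Reachable x y := by
    intro x hx y hy
    exact (C.takeUntil x hx).reachable.symm.trans (C.takeUntil y hy).reachable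
  set E : Set (Sym2 V) := {e | e ∈ C.edges} with hE
  have Lf := LD.seq (G := G) (E := E) (F := F) f a k hka hf hEf hFf
  have Lg := LD.seq (G := G) (E := E) (F := F) g b k hkb hg hEg hFg
  have LQ : ∀ x ∈ Q.support, LD G E F 0 (f 0) x := fun x hx => LD.walk Q hEQ hFQ hx
  have Luv : LD G E F 0 (f 0) (g 0) := LQ _ (by simp)
  have hcycle : C.IsCycle := by
    have hAp : A.IsPath := by
      rw [Walk.isPath_def, hAs]
      refine List.Nodup.map_on ?_ List.nodup_range
      intro x hx y hy h
      simp only [List.mem_range] at hx hy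
      exact seq_path dep f a hfd (by omega) (by omega) h
    have hBp : B.IsPath := by
      rw [Walk.isPath_def, hBs]
      refine List.Nodup.map_on ?_ List.nodup_range
      intro x hx y hy h
      simp only [List.mem_range] at hx hy
      exact seq_path dep g b hgd (by omega) (by omega) h
    have hRp : R.IsPath := by
      have hb1 : (B.copy rfl hm.symm).IsPath := by simpa using hBp
      have ha1 := hAp.reverse
      rw [Walk.isPath_def] at hb1 ha1 ⊢
      rw [hR, Walk.support_append, List.nodup_append']
      refine ⟨hb1, ha1.tail, ?_⟩
      intro x hx hx'
      have hx2 : x ∈ A.support := by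
        have := List.mem_of_mem_tail hx'
        simpa using this
      have hne : x ≠ f a := by
        rintro rfl
        have h3 : A.reverse.support = f a :: A.reverse.support.tail := by simp
        rw [h3] at ha1
        exact (List.nodup_cons.1 ha1).1 hx'
      rw [hAs] at hx2
      simp only [Walk.support_copy, hBs, List.mem_map, List.mem_range] at hx hx2
      obtain ⟨j, hj, rfl⟩ := hx
      obtain ⟨j', hj', h⟩ := hx2
      have := (hfg j' (by omega) j (by omega) h).1
      subst this
      exact hne h.symm
    refine Walk.IsPath.isCycle_append hQ hRp ?_ (Or.inl ?_)
    · intro x hx hx'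
      have hxQ := List.mem_of_mem_tail hx
      have hxR := List.mem_of_mem_tail hx'
      have hnf : x ≠ f 0 := by
        rintro rfl
        have h3 : Q.support = f 0 :: Q.support.tail := by simp
        have h4 := hQ.support_nodup
        rw [h3] at h4
        exact (List.nodup_cons.1 h4).1 hx
      have hng : x ≠ g 0 := by
        rintro rfl
        have h3 : R.support = g 0 :: R.support.tail := by simp
        have h4 := hRp.support_nodup
        rw [h3] at h4
        exact (List.nodup_cons.1 h4).1 hx'
      simp only [hR, Walk.mem_support_append_iff, Walk.support_reverse, Walk.support_copy,
        List.mem_reverse, hAs, hBs, List.mem_map, List.mem_range] at hxR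
      rcases hxR with ⟨j, hj, rfl⟩ | ⟨j, hj, rfl⟩
      · rcases j with _ | j
        · exact hng rfl
        · exact hgQ j (by omega) hxQ
      · rcases j with _ | j
        · exact hnf rfl
        · exact hfQ j (by omega) hxQ
    · have := G.dist_le Q
      omega
  refine ⟨_, C, F, ⟨hcycle, ?_, ?_⟩, ?_⟩
  · intro e heF
    simp only [hF, Finset.mem_union, Finset.mem_image, Finset.mem_range] at heF
    rcases heF with ⟨j, hj, rfl⟩ | ⟨j, hj, rfl⟩
    · exact hEf j (by omega)
    · exact hEg j (by omega)
  · intro x y hx hy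
    suffices h : LD G E F (G.dist x y) x y from h.path
    have hr := hreach x hx y hy
    have d1 := lip_dist dep hL hr
    have d2 := lip_dist dep hL hr.symm
    rw [G.dist_comm (u := y) (v := x)] at d2
    have caseff : ∀ j ≤ a, ∀ j' ≤ a, dep (f j) ≤ dep (f j') + G.dist x y →
        dep (f j') ≤ dep (f j) + G.dist x y → LD G E F (G.dist x y) (f j) (f j') := by
      intro j hj j' hj' d1 d2
      have := hfd j hj
      have := hfd j' hj'
      rcases le_total j j' with h | h
      · exact (Lf j' j h hj').mono (by omega)
      · exact (Lf j j' h hj).symm.mono (by omega)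
    have casegg : ∀ j ≤ b, ∀ j' ≤ b, dep (g j) ≤ dep (g j') + G.dist x y →
        dep (g j') ≤ dep (g j) + G.dist x y → LD G E F (G.dist x y) (g j) (g j') := by
      intro j hj j' hj' d1 d2
      have := hgd j hj
      have := hgd j' hj'
      rcases le_total j j' with h | h
      · exact (Lg j' j h hj').mono (by omega)
      · exact (Lg j j' h hj).symm.mono (by omega)
    have casefg : ∀ j ≤ a, ∀ j' ≤ b, dep (f j) ≤ dep (g j') + G.dist x y →
        dep (g j') ≤ dep (f j) + G.dist x y → 2 * k ≤ j + j' + G.dist x y →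
        LD G E F (G.dist x y) (f j) (g j') := by
      intro j hj j' hj' d1 d2 d3
      have := hfd j hj
      have := hgd j' hj'
      have t := Lf a j hj le_rfl
      rw [hm] at t
      exact (t.trans (Lg b j' hj' le_rfl).symm).mono (by omega)
    have casefQ : ∀ j ≤ a, ∀ z ∈ Q.support, i ≤ dep z → dep z ≤ dep (f j) + G.dist x y →
        LD G E F (G.dist x y) (f j) z := by
      intro j hj z hz hiz d
      have := hfd j hj
      exact ((Lf j 0 (by omega) hj).symm.trans (LQ z hz)).mono (by omega)
    have casegQ : ∀ j ≤ b, ∀ z ∈ Q.support, i ≤ dep z → dep z ≤ dep (g j) + G.dist x y →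
        LD G E F (G.dist x y) (g j) z := by
      intro j hj z hz hiz d
      have := hgd j hj
      exact ((Lg j 0 (by omega) hj).symm.trans (Luv.symm.trans (LQ z hz))).mono (by omega)
    rcases hCs x hx with ⟨j, hj, hxe⟩ | ⟨j, hj, hxe⟩ | ⟨hxQ, hxi⟩ <;>
    rcases hCs y hy with ⟨j', hj', hye⟩ | ⟨j', hj', hye⟩ | ⟨hyQ, hyi⟩
    · have := caseff j hj j' hj' (by rwa [← hxe, ← hye]) (by rwa [← hxe, ← hye])
      rwa [← hxe, ← hye] at this
    · have := casefg j hj j' hj' (by rwa [← hxe, ← hye]) (by rwa [← hxe, ← hye])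
        (by have := dfg j hj j' hj'; rwa [← hxe, ← hye] at this)
      rwa [← hxe, ← hye] at this
    · have := casefQ j hj y hyQ hyi (by rwa [← hxe])
      rwa [← hxe] at this
    · have := casefg j' hj' j hj (by rwa [← hxe, ← hye]) (by rwa [← hxe, ← hye])
        (by have := dfg j' hj' j hj; rwa [← hxe, ← hye, G.dist_comm] at this)
      rw [← hxe, ← hye] at this
      exact this.symm
    · have := casegg j hj j' hj' (by rwa [← hxe, ← hye]) (by rwa [← hxe, ← hye])
      rwa [← hxe, ← hye] at this
    · have := casegQ j hj y hyQ hyi (by rwa [← hxe])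
      rwa [← hxe] at this
    · have := casefQ j' hj' x hxQ hxi (by rwa [← hye])
      rw [← hye] at this
      exact this.symm
    · have := casegQ j' hj' x hxQ hxi (by rwa [← hye])
      rw [← hye] at this
      exact this.symm
    · exact ((LQ x hxQ).symm.trans (LQ y hyQ)).mono (by omega)
  · rw [hF, Finset.card_union_of_disjoint, Finset.card_image_of_injOn, Finset.card_image_of_injOn]
    · simp; omega
    · intro x hx y hy h
      simp only [Finset.coe_range, Set.mem_Iio] at hx hy
      exact seq_edge dep g b hgd (by omega) (by omega) h
    · intro x hx y hy h
      simp only [Finset.coe_range, Set.mem_Iio] at hx hy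
      exact seq_edge dep f a hfd (by omega) (by omega) h
    · rw [Finset.disjoint_left]
      intro e he he'
      simp only [Finset.mem_image, Finset.mem_range] at he he'
      obtain ⟨j, hj, rfl⟩ := he
      obtain ⟨j', hj', h⟩ := he'
      exact hefg j (by omega) j' (by omega) h.symm
end

theorem exists_dep {V : Type*} (G : SimpleGraph V) : ∃ dep : V → ℕ,
    (∀ x y, G.Adj x y → dep x ≤ dep y + 1) ∧
    (∀ x, dep x ≠ 0 → ∃ y, G.Adj x y ∧ dep y + 1 = dep x) ∧
    (∀ x y, dep x = 0 → dep y = 0 → G.Reachable x y → x = y) := by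
  let r : V → V := fun x => (G.connectedComponentMk x).out
  have hr : ∀ x, G.Reachable x (r x) := fun x =>
    (ConnectedComponent.exact (Quot.out_eq (G.connectedComponentMk x))).symm
  have hrr : ∀ x y, G.Reachable x y → r x = r y := fun x y h => by
    simp only [r]; rw [ConnectedComponent.sound h]
  have hw : ∀ x y, G.Adj x y → G.dist x (r x) ≤ G.dist y (r y) + 1 := by
    intro x y h
    rw [hrr x y h.reachable]
    obtain ⟨W, hW⟩ := (hr y).exists_walk_length_eq_dist
    have := G.dist_le (Walk.cons h W)
    simpa [hW] using this
  refine ⟨fun x => G.dist x (r x), hw, ?_, ?_⟩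
  · intro x hx
    obtain ⟨W, hW⟩ := (hr x).exists_walk_length_eq_dist
    have hnn : ¬ W.Nil := by
      intro hn
      rw [← Walk.length_eq_zero_iff, hW] at hn
      exact hx hn
    have h := Walk.adj_snd hnn
    refine ⟨W.snd, h, ?_⟩
    have h1 := hw x _ h
    have h2 := G.dist_le W.tail
    have h3 := Walk.length_tail_add_one hnn
    have h4 := hW
    have e : r x = r W.snd := hrr x _ h.reachable
    dsimp only
    rw [← e] at h1 ⊢
    omega
  · intro x y hx hy h
    have h1 := (hr x).dist_eq_zero_iff.1 hx
    have h2 := (hr y).dist_eq_zero_iff.1 hy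
    rw [h1, h2, hrr x y h]

theorem bagcyc {V : Type*} [DecidableEq V] {G : SimpleGraph V} (dep : V → ℕ)
    (hL : ∀ x y, G.Adj x y → dep x ≤ dep y + 1)
    (hP : ∀ x, dep x ≠ 0 → ∃ y, G.Adj x y ∧ dep y + 1 = dep x)
    (hZ : ∀ x y, dep x = 0 → dep y = 0 → G.Reachable x y → x = y)
    (i k : ℕ) (u v : V) (hui : dep u ≤ i) (hui' : i ≤ dep u + 1) (hvi : dep v ≤ i)
    (hvi' : i ≤ dep v + 1) (Q : G.Walk u v)
    (hQi : ∀ x ∈ Q.support, x = u ∨ x = v ∨ i ≤ dep x)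
    (hk : 1 ≤ k) (hd : 2 * k ≤ G.dist u v) :
    ∃ (a : V) (C : G.Walk a a) (F : Finset (Sym2 V)),
      IsGeodesicLoadedCycle G C F ∧ 2 * k ≤ F.card := by
  classical
  have hseq : ∀ n x, dep x = n → ∃ f : ℕ → V, f 0 = x ∧ (∀ j < n, G.Adj (f j) (f (j+1))) ∧
      ∀ j ≤ n, dep (f j) + j = n := by
    intro n
    induction n with
    | zero => intro x hx; exact ⟨fun _ => x, rfl, by omega, fun j hj => by dsimp only; omega⟩
    | succ n ih =>
      intro x hx
      obtain ⟨y, hxy, hy⟩ := hP x (by omega)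
      obtain ⟨f, f0, f1, f2⟩ := ih y (by omega)
      refine ⟨fun j => Nat.casesOn j x f, rfl, ?_, ?_⟩
      · intro j hj
        cases j with
        | zero => simpa [f0] using hxy
        | succ j => simpa using f1 j (by omega)
      · intro j hj
        cases j with
        | zero => simpa using hx
        | succ j => have := f2 j (by omega)
                    show dep (f j) + (j+1) = n+1
                    omega
  obtain ⟨f, rfl, f1, f2⟩ := hseq _ u rfl
  obtain ⟨g, rfl, g1, g2⟩ := hseq _ v rfl
  have hex : ∃ n, ∃ a b, a + b = n ∧ a ≤ dep (f 0) ∧ b ≤ dep (g 0) ∧ f a = g b := by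
    refine ⟨_, dep (f 0), dep (g 0), rfl, le_rfl, le_rfl, ?_⟩
    have h1 := f2 _ le_rfl
    have h2 := g2 _ le_rfl
    obtain ⟨A, -, -⟩ := fwalk G f _ f1
    obtain ⟨B, -, -⟩ := fwalk G g _ g1
    exact hZ _ _ (by omega) (by omega) (A.reachable.symm.trans (Q.reachable.trans B.reachable))
  obtain ⟨a, b, hab, ha, hb, hm⟩ := Nat.find_spec hex
  have hmin : ∀ j ≤ a, ∀ j' ≤ b, f j = g j' → j = a ∧ j' = b := by
    intro j hj j' hj' h
    have := Nat.find_min' hex ⟨j, j', rfl, by omega, by omega, h⟩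
    omega
  exact cyc dep hL i k a b f g (fun j hj => f1 j (by omega)) (fun j hj => g1 j (by omega))
    (fun j hj => f2 j (by omega)) (fun j hj => g2 j (by omega)) hmin hm hui hui' hvi hvi'
    Q.bypass Q.bypass_isPath (fun x hx => hQi x (Q.support_bypass_subset_support hx)) hk hd

def HW {V : Type*} (G : SimpleGraph V) (dep : V → ℕ) (n : ℕ) (x y : V) : Prop :=
  ∃ W : G.Walk x y, ∀ z ∈ W.support, n ≤ dep z

theorem HW.symm {V : Type*} {G : SimpleGraph V} {dep : V → ℕ} {n : ℕ} {x y : V}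
    (h : HW G dep n x y) : HW G dep n y x := by
  obtain ⟨W, hW⟩ := h
  exact ⟨W.reverse, by simpa using hW⟩

theorem HW.trans {V : Type*} {G : SimpleGraph V} {dep : V → ℕ} {n : ℕ} {x y z : V}
    (h : HW G dep n x y) (h' : HW G dep n y z) : HW G dep n x z := by
  obtain ⟨W, hW⟩ := h
  obtain ⟨W', hW'⟩ := h'
  refine ⟨W.append W', fun t ht => ?_⟩
  rw [Walk.mem_support_append_iff] at ht
  rcases ht with ht | ht
  · exact hW t ht
  · exact hW' t ht

theorem HW.adj {V : Type*} {G : SimpleGraph V} {dep : V → ℕ} {n : ℕ} {x y : V}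
    (h : G.Adj x y) (hx : n ≤ dep x) (hy : n ≤ dep y) : HW G dep n x y := by
  refine ⟨Walk.cons h Walk.nil, fun t ht => ?_⟩
  simp at ht
  rcases ht with rfl | rfl <;> assumption

theorem HW.mono {V : Type*} {G : SimpleGraph V} {dep : V → ℕ} {n m : ℕ} {x y : V}
    (h : HW G dep n x y) (hm : m ≤ n) : HW G dep m x y := by
  obtain ⟨W, hW⟩ := h
  exact ⟨W, fun z hz => hm.trans (hW z hz)⟩

def clus {V : Type u} (G : SimpleGraph V) (dep : V → ℕ) : Setoid V where
  r x y := dep x = dep y ∧ (dep x = 0 ∨ HW G dep (dep x) x y)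
  iseqv := by
    refine ⟨fun x => ⟨rfl, Or.inr ⟨Walk.nil, by simp⟩⟩, ?_, ?_⟩
    · rintro x y ⟨h, h'⟩
      refine ⟨h.symm, ?_⟩
      rw [← h]
      exact h'.imp id HW.symm
    · rintro x y z ⟨h1, h1'⟩ ⟨h2, h2'⟩
      refine ⟨h1.trans h2, ?_⟩
      rw [← h1] at h2'
      rcases h1' with h | h
      · exact Or.inl h
      · rcases h2' with h' | h'
        · exact Or.inl h'
        · exact Or.inr (h.trans h')

theorem decomp {V : Type u} [Nonempty V] (G : SimpleGraph V) (dep : V → ℕ)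
    (hL : ∀ x y, G.Adj x y → dep x ≤ dep y + 1)
    (hP : ∀ x, dep x ≠ 0 → ∃ y, G.Adj x y ∧ dep y + 1 = dep x) :
    ∃ T : SimpleGraph (Quotient (clus G dep)), TreeDecomp G T
      (fun q => {x | Quotient.mk (clus G dep) x = q ∨
        ∃ c, Quotient.mk (clus G dep) c = q ∧ G.Adj x c ∧ dep x + 1 = dep c}) := by
  classical
  let S := clus G dep
  have hS : ∀ x y, Quotient.mk S x = Quotient.mk S y ↔
      dep x = dep y ∧ (dep x = 0 ∨ HW G dep (dep x) x y) := fun x y => Quotient.eq (r := S)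
  choose p hp1 hp2 using hP
  let par : Quotient S → Quotient S := fun q =>
    if h : dep q.out ≠ 0 then Quotient.mk S (p q.out h) else q
  let lev : Quotient S → ℕ := fun q => dep q.out
  have hlev : ∀ x, lev (Quotient.mk S x) = dep x := fun x =>
    ((hS _ _).1 (Quotient.out_eq (Quotient.mk S x))).1
  have hpar : ∀ x c, G.Adj x c → dep x + 1 = dep c →
      par (Quotient.mk S c) = Quotient.mk S x := by
    intro x c hxc hd
    obtain ⟨e1, e2⟩ := (hS _ _).1 (Quotient.out_eq (Quotient.mk S c))
    have hne : dep (Quotient.mk S c).out ≠ 0 := by omega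
    simp only [par]
    rw [dif_pos hne, hS]
    have h1 := hp1 _ hne
    have h2 := hp2 _ hne
    refine ⟨by omega, Or.inr ?_⟩
    rcases e2 with e2 | e2
    · exact absurd e2 hne
    · refine (HW.adj h1.symm le_rfl (by omega)).trans ((e2.mono (by omega)).trans
        (HW.adj hxc.symm (by omega) (by omega)))
  have h1 : ∀ w, lev w ≠ 0 → lev (par w) + 1 = lev w := by
    intro w hw
    have h2 := hp2 _ hw
    have : par w = Quotient.mk S (p w.out hw) := dif_pos hw
    rw [this, hlev]
    exact h2
  have hroot : ∃ r : V, dep r = 0 := by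
    obtain ⟨x⟩ := (inferInstance : Nonempty V)
    have : ∀ n x, dep x = n → ∃ r, dep r = 0 := by
      intro n
      induction n with
      | zero => intro x hx; exact ⟨x, hx⟩
      | succ n ih => intro x hx
                     have hne : dep x ≠ 0 := by omega
                     have := hp2 x hne
                     exact ih (p x hne) (by omega)
    exact this _ x rfl
  obtain ⟨r, hr⟩ := hroot
  have h0 : ∀ w, lev w = 0 → w = Quotient.mk S r := by
    intro w hw
    rw [← Quotient.out_eq w, hS]
    exact ⟨hw.trans hr.symm, Or.inl hw⟩
  let T : SimpleGraph (Quotient S) :=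
    { Adj := fun a b => (lev a ≠ 0 ∧ par a = b) ∨ (lev b ≠ 0 ∧ par b = a)
      symm := ⟨fun a b h => h.symm⟩
      loopless := ⟨fun a h => by
        have : lev a ≠ 0 ∧ par a = a := by rcases h with h | h <;> exact h
        have h2 := h1 a this.1
        rw [this.2] at h2
        omega⟩ }
  have hT := ptree par lev _ h0 h1 T (fun a b => Iff.rfl)
  refine ⟨T, hT, ?_, ?_, ?_⟩
  · intro v
    exact ⟨Quotient.mk S v, Or.inl rfl⟩
  · intro u v h
    have d1 := hL u v h
    have d2 := hL v u h.symm
    rcases lt_trichotomy (dep u) (dep v) with h3 | h3 | h3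
    · exact ⟨Quotient.mk S v, Or.inr ⟨v, rfl, h, by omega⟩, Or.inl rfl⟩
    · exact ⟨Quotient.mk S v, Or.inl ((hS _ _).2 ⟨h3, Or.inr (HW.adj h le_rfl h3.le)⟩), Or.inl rfl⟩
    · exact ⟨Quotient.mk S u, Or.inl rfl, Or.inr ⟨u, rfl, h.symm, by omega⟩⟩
  · intro t1 t2 t3 P hP ht2 x hx
    have hstar : ∀ t, (Quotient.mk S x = t ∨
        ∃ c, Quotient.mk S c = t ∧ G.Adj x c ∧ dep x + 1 = dep c) →
        ∃ W : T.Walk t (Quotient.mk S x), ∀ s ∈ W.support, s = t ∨ s = Quotient.mk S x := by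
      rintro t (rfl | ⟨c, rfl, hc, hd⟩)
      · exact ⟨Walk.nil, by simp⟩
      · have ha : T.Adj (Quotient.mk S c) (Quotient.mk S x) := by
          refine Or.inl ⟨?_, hpar x c hc hd⟩
          rw [hlev]; omega
        exact ⟨Walk.cons ha Walk.nil, by simp⟩
    obtain ⟨W1, hW1⟩ := hstar t1 hx.1
    obtain ⟨W3, hW3⟩ := hstar t3 hx.2
    have huniq : P = (W1.append W3.reverse).bypass :=
      (hT.existsUnique_path t1 t3).unique hP (Walk.bypass_isPath _)
    rw [huniq] at ht2
    have := Walk.support_bypass_subset_support _ ht2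
    rw [Walk.mem_support_append_iff, Walk.support_reverse, List.mem_reverse] at this
    rcases this with h | h
    · rcases hW1 _ h with rfl | rfl
      · exact hx.1
      · exact Or.inl rfl
    · rcases hW3 _ h with rfl | rfl
      · exact hx.2
      · exact Or.inl rfl

/-- glc(G) ≥ 2·⌊odw(G)/2⌋ (and hence odw(G) − 1 ≤ glc(G)): if every tree-decomposition of G
has some bag containing two vertices at G-distance at least d (i.e. odw(G) ≥ d), where d ≥ 2,
then G has a geodesic loaded cycle of load at least 2·⌊d/2⌋. -/
theorem stmt_7 {V : Type u} [DecidableEq V] (G : SimpleGraph V) (d : ℕ) (hd : 2 ≤ d)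
    (hlower : ∀ {W : Type u} (T : SimpleGraph W) (B : W → Set V), TreeDecomp G T B →
      ∃ t : W, ∃ u ∈ B t, ∃ v ∈ B t, d ≤ G.dist u v) :
    ∃ (a : V) (C : G.Walk a a) (F : Finset (Sym2 V)),
      IsGeodesicLoadedCycle G C F ∧ 2 * (d / 2) ≤ F.card := by
  classical
  obtain ⟨dep, hL, hP, hZ⟩ := exists_dep G
  rcases isEmpty_or_nonempty V with hV | hV
  · have htd : TreeDecomp G (⊥ : SimpleGraph PUnit.{u+1}) (fun _ => (∅ : Set V)) :=
      { isTree := IsTree.of_subsingleton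
        coversVertices := fun v => hV.elim v
        coversEdges := fun v => hV.elim v
        interpolation := fun _ _ _ _ _ _ x => hV.elim x }
    obtain ⟨_, x, _⟩ := hlower _ _ htd
    exact hV.elim x
  obtain ⟨T, hT⟩ := decomp G dep hL hP
  obtain ⟨t, u, hu, v, hv, huv⟩ := hlower _ _ hT
  have hS : ∀ x y, Quotient.mk (clus G dep) x = Quotient.mk (clus G dep) y ↔
      dep x = dep y ∧ (dep x = 0 ∨ HW G dep (dep x) x y) :=
    fun x y => Quotient.eq (r := clus G dep)
  have hreach : G.Reachable u v := Reachable.of_dist_ne_zero (by omega)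
  obtain ⟨w, rfl⟩ := Quotient.exists_rep t
  have hbag : ∀ x, (Quotient.mk (clus G dep) x = Quotient.mk (clus G dep) w ∨
      ∃ c, Quotient.mk (clus G dep) c = Quotient.mk (clus G dep) w ∧ G.Adj x c ∧
        dep x + 1 = dep c) → dep x ≤ dep w ∧ dep w ≤ dep x + 1 ∧ (dep w ≠ 0 →
        ∃ W : G.Walk x w, ∀ z ∈ W.support, z = x ∨ dep w ≤ dep z) := by
    rintro x (h | ⟨c, h, hc, hd⟩)
    · obtain ⟨h1, h2⟩ := (hS _ _).1 h
      refine ⟨by omega, by omega, fun hw => ?_⟩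
      rcases h2 with h2 | ⟨W, hW⟩
      · omega
      · exact ⟨W, fun z hz => Or.inr (h1 ▸ hW z hz)⟩
    · obtain ⟨h1, h2⟩ := (hS _ _).1 h
      refine ⟨by omega, by omega, fun hw => ?_⟩
      rcases h2 with h2 | ⟨W, hW⟩
      · omega
      · refine ⟨Walk.cons hc W, fun z hz => ?_⟩
        rw [Walk.support_cons, List.mem_cons] at hz
        rcases hz with hz | hz
        · exact Or.inl hz
        · exact Or.inr (h1 ▸ hW z hz)
  obtain ⟨u1, u2, u3⟩ := hbag u hu
  obtain ⟨v1, v2, v3⟩ := hbag v hv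
  have hw : dep w ≠ 0 := by
    intro hw
    have := hZ u v (by omega) (by omega) hreach
    subst this
    simp at huv
    omega
  obtain ⟨W1, hW1⟩ := u3 hw
  obtain ⟨W2, hW2⟩ := v3 hw
  refine bagcyc dep hL hP hZ (dep w) (d / 2) u v u1 u2 v1 v2 (W1.append W2.reverse) ?_
    (by omega) (by omega)
  intro x hx
  rw [Walk.mem_support_append_iff, Walk.support_reverse, List.mem_reverse] at hx
  rcases hx with hx | hx
  · rcases hW1 x hx with h | h
    · exact Or.inl h
    · exact Or.inr (Or.inr h)
  · rcases hW2 x hx with h | h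
    · exact Or.inr (Or.inl h)
    · exact Or.inr (Or.inr h)
end

section
/- If a graph G has bottleneck constant Δ ≥ 1, then glc(G) ≥ 2Δ: there is a geodesic loaded cycle of G with load 2Δ. -/
open SimpleGraph

/-- G satisfies the bottleneck property with constant k: for every geodesic path P of G of
even length between u and v with middle vertex w, every path of G between u and v contains
a vertex at distance at most k from w. -/
def BottleneckProp {V : Type*} (G : SimpleGraph V) (k : ℕ) : Prop :=
  ∀ (u v w : V) (P : G.Walk u v), P.IsPath → P.length = G.dist u v →
    w ∈ P.support → G.dist u w = G.dist w v → 2 * G.dist u w = P.length →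
    ∀ Q : G.Walk u v, ∃ z ∈ Q.support, G.dist w z ≤ k

lemma aux_tri {V : Type*} {G : SimpleGraph V} {u v w : V} (h1 : G.Reachable u v)
    (h2 : G.Reachable v w) : G.dist u w ≤ G.dist u v + G.dist v w := by
  obtain ⟨p, hp⟩ := h1.exists_walk_length_eq_dist
  obtain ⟨q, hq⟩ := h2.exists_walk_length_eq_dist
  have := G.dist_le (p.append q)
  rw [Walk.length_append] at this
  omega

lemma aux_geo {V : Type*} {G : SimpleGraph V} {u x y v : V} (A : G.Walk u x) (B : G.Walk x y)
    (C : G.Walk y v) (h : A.length + B.length + C.length ≤ G.dist u v) :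
    B.length = G.dist x y := by
  have h1 := G.dist_le A
  have h2 := G.dist_le B
  have h3 := G.dist_le C
  have h4 := aux_tri A.reachable B.reachable
  have h5 := aux_tri (A.append B).reachable C.reachable
  omega

lemma aux_split {V : Type*} [DecidableEq V] {G : SimpleGraph V} {u w : V} (Δ : ℕ) (P : G.Walk u w)
    (hP : P.length = G.dist u w) (h : Δ ≤ P.length) :
    ∃ (a : V) (A : G.Walk u a) (S : G.Walk a w), A.length + S.length = P.length ∧ S.length = Δ ∧
      G.dist a w = Δ ∧ (∀ z ∈ A.support, Δ ≤ G.dist w z) ∧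
      (∀ z (hz : z ∈ S.support), (S.takeUntil z hz).length + G.dist w z = Δ) := by
  have hl : (P.take (P.length - Δ)).length + (P.drop (P.length - Δ)).length = P.length := by
    rw [← Walk.length_append, Walk.append_take_drop_eq]
  have hd : (P.drop (P.length - Δ)).length = Δ := by
    rw [Walk.drop_length]; omega
  generalize P.drop (P.length - Δ) = S at *
  generalize P.take (P.length - Δ) = A at *
  generalize P.getVert (P.length - Δ) = a at *
  have ha : S.length = G.dist a w := aux_geo A S Walk.nil (by simp; omega)
  refine ⟨a, A, S, hl, hd, by omega, ?_, ?_⟩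
  · intro z hz
    have e := congrArg Walk.length (A.take_spec hz)
    rw [Walk.length_append] at e
    have := aux_geo (A.takeUntil z hz) ((A.dropUntil z hz).append S) Walk.nil
      (by simp; omega)
    rw [Walk.length_append, SimpleGraph.dist_comm] at this
    omega
  · intro z hz
    have e := congrArg Walk.length (S.take_spec hz)
    rw [Walk.length_append] at e
    have := aux_geo (A.append (S.takeUntil z hz)) (S.dropUntil z hz) Walk.nil
      (by simp; omega)
    rw [SimpleGraph.dist_comm] at this
    omega

lemma aux_sub {V : Type*} [DecidableEq V] {G : SimpleGraph V} {a b x y : V} (S : G.Walk a b)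
    (hS : S.length = G.dist a b) (hx : x ∈ S.support) (hy : y ∈ S.support) :
    ∃ T : G.Walk x y, (∀ e ∈ T.edges, e ∈ S.edges) ∧ T.length = G.dist x y := by
  have e := congrArg Walk.length (S.take_spec hx)
  rw [Walk.length_append] at e
  have hy' := hy
  rw [← S.take_spec hx, Walk.mem_support_append_iff] at hy'
  rcases hy' with h | h
  · have e2 := congrArg Walk.length ((S.takeUntil x hx).take_spec h)
    rw [Walk.length_append] at e2
    refine ⟨((S.takeUntil x hx).dropUntil y h).reverse, ?_, ?_⟩
    · intro e he
      rw [Walk.edges_reverse, List.mem_reverse] at he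
      exact S.edges_takeUntil_subset_edges hx (Walk.edges_dropUntil_subset_edges _ h he)
    · rw [Walk.length_reverse, SimpleGraph.dist_comm]
      exact aux_geo ((S.takeUntil x hx).takeUntil y h) _ (S.dropUntil x hx) (by omega)
  · have e2 := congrArg Walk.length ((S.dropUntil x hx).take_spec h)
    rw [Walk.length_append] at e2
    refine ⟨((S.dropUntil x hx).takeUntil y h), ?_, ?_⟩
    · intro e he
      exact S.edges_dropUntil_subset_edges hx (Walk.edges_takeUntil_subset_edges _ h he)
    · exact aux_geo (S.takeUntil x hx) _ ((S.dropUntil x hx).dropUntil y h) (by omega)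

lemma aux_card {V : Type*} [DecidableEq V] {G : SimpleGraph V} {x z y : V} (F : Finset (Sym2 V))
    (T : G.Walk x z) (U : G.Walk z y) (hU : ∀ e ∈ U.edges, e ∉ F) :
    (F ∩ (T.append U).bypass.edges.toFinset).card ≤ T.length := by
  rw [← Walk.length_edges]
  refine le_trans (Finset.card_le_card ?_) T.edges.toFinset_card_le
  intro e he
  simp only [Finset.mem_inter, List.mem_toFinset] at he ⊢
  have := Walk.edges_bypass_subset_edges _ he.2
  rw [Walk.edges_append, List.mem_append] at this
  exact this.resolve_right fun h => hU e h he.1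

/-- If G has bottleneck constant Δ ≥ 1 (Δ is the least constant with the bottleneck property),
then G has a geodesic loaded cycle of load 2Δ; hence glc(G) ≥ 2Δ. -/
theorem stmt_13 {V : Type*} [DecidableEq V] (G : SimpleGraph V) (Δ : ℕ) (hΔ : 1 ≤ Δ)
    (hbp : BottleneckProp G Δ) (hmin : ∀ j : ℕ, BottleneckProp G j → Δ ≤ j) :
    ∃ (a : V) (C : G.Walk a a) (F : Finset (Sym2 V)),
      IsGeodesicLoadedCycle G C F ∧ F.card = 2 * Δ := by
  have hn : ¬ BottleneckProp G (Δ - 1) := fun h => by have := hmin _ h; omega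
  unfold BottleneckProp at hn
  push Not at hn
  obtain ⟨u, v, w, P, hP, hPl, hw, huw, h2, Q, hQ⟩ := hn
  have e := congrArg Walk.length (P.take_spec hw)
  rw [Walk.length_append] at e
  have g1 : (P.takeUntil w hw).length = G.dist u w :=
    aux_geo Walk.nil _ (P.dropUntil w hw) (by simp; omega)
  have g2 : (P.dropUntil w hw).reverse.length = G.dist v w := by
    rw [Walk.length_reverse, SimpleGraph.dist_comm]
    exact aux_geo (P.takeUntil w hw) _ Walk.nil (by simp; omega)
  have hu : Δ ≤ G.dist u w := by
    have := hQ u Q.start_mem_support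
    rw [SimpleGraph.dist_comm] at this; omega
  have hv : G.dist v w = G.dist u w := by rw [huw, SimpleGraph.dist_comm]
  obtain ⟨a, A, S1, hA, hS1, haw, hAz, hS1z⟩ := aux_split Δ _ g1 (by omega)
  obtain ⟨b, B, S2, hB, hS2, hbw, hBz, hS2z⟩ := aux_split Δ _ g2 (by omega)
  obtain ⟨S, hSdef⟩ : ∃ S, S = S1.append S2.reverse := ⟨_, rfl⟩
  have hSl : S.length = 2 * Δ := by rw [hSdef]; simp; omega
  have hS : S.length = G.dist a b := aux_geo A S B.reverse (by simp; omega)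
  have hSp : S.IsPath := S.isPath_of_length_eq_dist hS
  obtain ⟨R, hRdef⟩ : ∃ R, R = (A.reverse.append (Q.append B)).bypass := ⟨_, rfl⟩
  have hRp : R.IsPath := hRdef ▸ Walk.bypass_isPath _
  have hRz : ∀ z ∈ R.support, Δ ≤ G.dist w z := by
    intro z hz
    rw [hRdef] at hz
    have := Walk.support_bypass_subset_support _ hz
    simp only [Walk.mem_support_append_iff, Walk.support_reverse, List.mem_reverse] at this
    rcases this with h | h | h
    · exact hAz z h
    · have := hQ z h; omega
    · exact hBz z h
  clear hRdef
  have hSs : ∀ z, z ∈ S.support ↔ z ∈ S1.support ∨ z ∈ S2.support := by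
    intro z; rw [hSdef]; simp [Walk.mem_support_append_iff]
  have hSe : ∀ z, z ∈ S.edges ↔ z ∈ S1.edges ∨ z ∈ S2.edges := by
    intro z; rw [hSdef]; simp
  have hSR : ∀ z ∈ S.support, z ∈ R.support → z = a ∨ z = b := by
    intro z hz hr
    have hr := hRz z hr
    rcases (hSs z).1 hz with h | h
    · have := hS1z z h
      exact Or.inl (Walk.eq_of_length_eq_zero (p := S1.takeUntil z h) (by omega)).symm
    · have := hS2z z h
      exact Or.inr (Walk.eq_of_length_eq_zero (p := S2.takeUntil z h) (by omega)).symm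
  have hdisj : ∀ e ∈ S.edges, e ∉ R.edges := by
    intro e
    induction e with | _ x y
    intro h1 h2
    have hxy := S.adj_of_mem_edges h1
    have hx := hSR x (S.fst_mem_support_of_mem_edges h1) (R.fst_mem_support_of_mem_edges h2)
    have hy := hSR y (S.snd_mem_support_of_mem_edges h1) (R.snd_mem_support_of_mem_edges h2)
    have hab : G.Adj a b := by
      rcases hx with rfl | rfl <;> rcases hy with rfl | rfl
      · exact absurd rfl hxy.ne
      · exact hxy
      · exact hxy.symm
      · exact absurd rfl hxy.ne
    have := dist_eq_one_iff_adj.2 hab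
    omega
  have key : ∀ x ∈ S.support, ∀ y ∈ R.support, ∃ T : G.Walk x y, T.IsPath ∧
      (∀ e ∈ T.edges, e ∈ S.edges ∨ e ∈ R.edges) ∧
      (S.edges.toFinset ∩ T.edges.toFinset).card ≤ G.dist x y := by
    intro x hx y hy
    have hry := hRz y hy
    rcases (hSs x).1 hx with h | h
    · refine ⟨((S1.takeUntil x h).reverse.append (R.takeUntil y hy)).bypass,
        Walk.bypass_isPath _, ?_, ?_⟩
      · intro e he
        have := Walk.edges_bypass_subset_edges _ he
        rw [Walk.edges_append, List.mem_append, Walk.edges_reverse, List.mem_reverse] at this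
        rcases this with h' | h'
        · exact Or.inl ((hSe e).2 (Or.inl (S1.edges_takeUntil_subset_edges h h')))
        · exact Or.inr (R.edges_takeUntil_subset_edges hy h')
      · refine (aux_card _ _ _ ?_).trans ?_
        · intro e he hF
          exact hdisj e (List.mem_toFinset.1 hF) (R.edges_takeUntil_subset_edges hy he)
        · have h1 := hS1z x h
          have h2 := aux_tri (S1.dropUntil x h).reverse.reachable
            ((S1.takeUntil x h).reverse.append (R.takeUntil y hy)).reachable
          rw [Walk.length_reverse]; omega
    · have hy' : y ∈ R.reverse.support := by simpa using hy
      have hR' : ∀ e ∈ (R.reverse.takeUntil y hy').edges, e ∈ R.edges := by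
        intro e he
        have := R.reverse.edges_takeUntil_subset_edges hy' he
        simpa using this
      refine ⟨((S2.takeUntil x h).reverse.append (R.reverse.takeUntil y hy')).bypass,
        Walk.bypass_isPath _, ?_, ?_⟩
      · intro e he
        have := Walk.edges_bypass_subset_edges _ he
        rw [Walk.edges_append, List.mem_append, Walk.edges_reverse, List.mem_reverse] at this
        rcases this with h' | h'
        · exact Or.inl ((hSe e).2 (Or.inr (S2.edges_takeUntil_subset_edges h h')))
        · exact Or.inr (hR' e h')
      · refine (aux_card _ _ _ ?_).trans ?_
        · intro e he hF
          exact hdisj e (List.mem_toFinset.1 hF) (hR' e he)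
        · have h1 := hS2z x h
          have h2 := aux_tri (S2.dropUntil x h).reverse.reachable
            ((S2.takeUntil x h).reverse.append (R.reverse.takeUntil y hy')).reachable
          rw [Walk.length_reverse]; omega
  have hCe : ∀ e, e ∈ (S.append R.reverse).edges ↔ e ∈ S.edges ∨ e ∈ R.edges := by
    intro e; simp
  have hCs : ∀ z, z ∈ (S.append R.reverse).support ↔ z ∈ S.support ∨ z ∈ R.support := by
    intro z; simp [Walk.mem_support_append_iff]
  refine ⟨a, S.append R.reverse, S.edges.toFinset, ⟨?_, ?_, ?_⟩, ?_⟩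
  · rw [Walk.isCycle_def]
    refine ⟨⟨?_⟩, ?_, ?_⟩
    · rw [Walk.edges_append, List.nodup_append']
      refine ⟨hSp.isTrail.edges_nodup, hRp.reverse.isTrail.edges_nodup, ?_⟩
      intro e h1 h2
      exact hdisj e h1 (by simpa using h2)
    · intro h
      have := congrArg Walk.length h
      rw [Walk.length_append, Walk.length_nil] at this; omega
    · rw [Walk.tail_support_append, List.nodup_append']
      have n1 := hSp.support_nodup
      have n2 := hRp.reverse.support_nodup
      refine ⟨n1.tail, n2.tail, ?_⟩
      intro z h1 h2
      have m2 := List.mem_of_mem_tail h2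
      rw [Walk.support_reverse, List.mem_reverse] at m2
      rw [← Walk.cons_tail_support, List.nodup_cons] at n1 n2
      rcases hSR z (List.mem_of_mem_tail h1) m2 with rfl | rfl
      · exact n1.1 h1
      · exact n2.1 h2
  · intro e he
    exact (hCe e).2 (Or.inl (List.mem_toFinset.1 he))
  · intro x y hx hy
    simp only [hCe]
    rcases (hCs x).1 hx with hx | hx <;> rcases (hCs y).1 hy with hy | hy
    · obtain ⟨T, hT, hl⟩ := aux_sub S hS hx hy
      refine ⟨T, T.isPath_of_length_eq_dist hl, fun e he => Or.inl (hT e he), ?_⟩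
      rw [← hl, ← Walk.length_edges]
      exact (Finset.card_le_card Finset.inter_subset_right).trans T.edges.toFinset_card_le
    · exact key x hx y hy
    · obtain ⟨T, h1, h2, h3⟩ := key y hy x hx
      refine ⟨T.reverse, h1.reverse, ?_, ?_⟩
      · intro e he
        exact h2 e (by simpa using he)
      · rw [SimpleGraph.dist_comm]
        simpa using h3
    · have hR' : ∀ e ∈ ((R.takeUntil x hx).reverse.append (R.takeUntil y hy)).edges,
          e ∈ R.edges := by
        intro e he
        rw [Walk.edges_append, List.mem_append, Walk.edges_reverse, List.mem_reverse] at he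
        rcases he with h | h
        · exact R.edges_takeUntil_subset_edges hx h
        · exact R.edges_takeUntil_subset_edges hy h
      refine ⟨((Walk.nil : G.Walk x x).append
        ((R.takeUntil x hx).reverse.append (R.takeUntil y hy))).bypass,
        Walk.bypass_isPath _, ?_, ?_⟩
      · intro e he
        exact Or.inr (hR' e (Walk.edges_bypass_subset_edges _ he))
      · refine (aux_card _ _ _ ?_).trans (Nat.zero_le _)
        intro e he hF
        exact hdisj e (List.mem_toFinset.1 hF) (hR' e he)
  · rw [List.toFinset_card_of_nodup hSp.isTrail.edges_nodup, Walk.length_edges, hSl]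
end
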